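/- arXiv:1712.03895 — 2 statements merged into one kernel-verified Lean document; each statement's English description precedes it below -/
import Mathlib

section
/- Let d ≥ 1 and let A, B ∈ ℂ[x,y] be homogeneous of degree d with gcd(A,B) = 1, defining the homogeneous foliation H by ω = A dx + B dy. Let x₀ ∈ ℂ satisfy x₀·A(x₀,1) + B(x₀,1) = 0 (i.e. the point s = [x₀:1:0] on the line at infinity is a singular point of H). Then: (1) A(x₀,1) ≠ 0 (so the singularity s has algebraic multiplicity ν(H,s) = 1); (2) letting τ ≥ 1 be the order of vanishing at x = x₀ of the univariate polynomial x₀·A(x,1) + B(x,1), the linear form x − x₀·y divides the polynomial D = A_x B_y − A_y B_x with multiplicity exactly τ − 1, i.e. D = (x − x₀y)^{τ−1}·Q with Q ∈ ℂ[x,y] and Q(x₀,1) ≠ 0. -/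
open MvPolynomial

noncomputable section

/-- Dehomogenization `A(x, 1)` of a polynomial in two variables, as a univariate
polynomial. -/
def dehomY1 (P : MvPolynomial (Fin 2) ℂ) : Polynomial ℂ :=
  MvPolynomial.aeval (![Polynomial.X, 1] : Fin 2 → Polynomial ℂ) P

theorem aux_sub (x₀ : ℂ) (P : MvPolynomial (Fin 2) ℂ) :
    (X 0 - C x₀ * X 1 : MvPolynomial (Fin 2) ℂ) ∣
      P - aeval (![C x₀ * X 1, X 1] : Fin 2 → MvPolynomial (Fin 2) ℂ) P := by
  induction P using MvPolynomial.induction_on with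
  | C a => simp [MvPolynomial.algebraMap_eq]
  | add p q hp hq =>
    rw [map_add]
    convert dvd_add hp hq using 1
    ring
  | mul_X p i hp =>
    obtain ⟨w, hw⟩ := hp
    rw [map_mul, aeval_X]
    fin_cases i
    · refine ⟨w * X 0 + aeval (![C x₀ * X 1, X 1] : Fin 2 → MvPolynomial (Fin 2) ℂ) p, ?_⟩
      simp only [Fin.zero_eta, Fin.isValue, Matrix.cons_val_zero]
      linear_combination (X 0 : MvPolynomial (Fin 2) ℂ) * hw
    · refine ⟨w * X 1, ?_⟩
      simp only [Fin.mk_one, Fin.isValue, Matrix.cons_val_one, Matrix.cons_val_fin_one]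
      linear_combination (X 1 : MvPolynomial (Fin 2) ℂ) * hw

theorem aux_hom (x₀ : ℂ) (n : ℕ) (P : MvPolynomial (Fin 2) ℂ) (hP : P.IsHomogeneous n) :
    aeval (![C x₀ * X 1, X 1] : Fin 2 → MvPolynomial (Fin 2) ℂ) P
      = X 1 ^ n * C (eval ![x₀, 1] P) := by
  rw [aeval_def, eval₂_eq', eval_eq', map_sum, Finset.mul_sum]
  refine Finset.sum_congr rfl fun m hm => ?_
  have h := hP (mem_support_iff.mp hm)
  have h2 : m 0 + m 1 = n := by
    rw [← h, Finsupp.weight_apply, Finsupp.sum_fintype] <;> simp [Fin.sum_univ_two]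
  simp [Fin.prod_univ_two, ← h2, MvPolynomial.algebraMap_eq]
  ring

theorem aux_L (x₀ : ℂ) : (X 0 - C x₀ * X 1 : MvPolynomial (Fin 2) ℂ).IsHomogeneous 1 :=
  (isHomogeneous_X ℂ 0).sub ((isHomogeneous_X ℂ 1).C_mul x₀)

theorem aux_div (x₀ : ℂ) (n : ℕ) (P : MvPolynomial (Fin 2) ℂ) (hP : P.IsHomogeneous n)
    (h0 : eval ![x₀, 1] P = 0) :
    ∃ m G, IsHomogeneous G m ∧ P = (X 0 - C x₀ * X 1) * G := by
  have h1 := aux_sub x₀ P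
  rw [aux_hom x₀ n P hP, h0] at h1
  simp only [map_zero, mul_zero, sub_zero] at h1
  obtain ⟨H, hH⟩ := h1
  refine ⟨n - 1, ∑ i ∈ Finset.range (H.totalDegree + 1),
    if i + 1 = n then homogeneousComponent i H else 0, ?_, ?_⟩
  · refine IsHomogeneous.sum _ _ _ fun i _ => ?_
    split_ifs with h
    · subst h
      exact homogeneousComponent_isHomogeneous _ _
    · exact isHomogeneous_zero _ _ _
  · have h2 : P = homogeneousComponent n P := by
      rw [homogeneousComponent_of_mem hP, if_pos rfl]
    rw [h2, hH]
    conv_lhs => rw [← sum_homogeneousComponent H]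
    rw [Finset.mul_sum, Finset.mul_sum, map_sum]
    refine Finset.sum_congr rfl fun i _ => ?_
    rw [homogeneousComponent_of_mem ((aux_L x₀).mul (homogeneousComponent_isHomogeneous i H))]
    by_cases h : i + 1 = n
    · rw [if_pos h, if_pos (by omega)]
    · rw [if_neg h, if_neg (by omega), mul_zero]

theorem aux_eval (x₀ : ℂ) (P : MvPolynomial (Fin 2) ℂ) :
    (dehomY1 P).eval x₀ = eval ![x₀, 1] P := by
  induction P using MvPolynomial.induction_on with
  | C a => simp [dehomY1]
  | add p q hp hq => simp only [dehomY1, map_add, Polynomial.eval_add] at *; rw [hp, hq]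
  | mul_X p i hp =>
    simp only [dehomY1, map_mul, Polynomial.eval_mul] at *
    rw [hp]
    fin_cases i <;> simp

theorem aux_dehomL (x₀ : ℂ) :
    dehomY1 (X 0 - C x₀ * X 1) = Polynomial.X - Polynomial.C x₀ := by
  simp [dehomY1]

theorem aux_pow (x₀ : ℂ) (n : ℕ) (P : MvPolynomial (Fin 2) ℂ) (hP : P.IsHomogeneous n) (k : ℕ)
    (h : (Polynomial.X - Polynomial.C x₀) ^ k ∣ dehomY1 P) :
    ∃ m G, IsHomogeneous G m ∧ P = (X 0 - C x₀ * X 1) ^ k * G := by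
  induction k with
  | zero => exact ⟨n, P, hP, by simp⟩
  | succ k ih =>
    obtain ⟨m, G, hG, hPG⟩ := ih (dvd_trans (pow_dvd_pow _ (Nat.le_succ k)) h)
    have e : dehomY1 P = (Polynomial.X - Polynomial.C x₀) ^ k * dehomY1 G := by
      rw [← aux_dehomL, hPG]; simp only [dehomY1, map_mul, map_pow]
    rw [e, pow_succ] at h
    have h' := (mul_dvd_mul_iff_left (pow_ne_zero k (Polynomial.X_sub_C_ne_zero x₀))).mp h
    rw [Polynomial.dvd_iff_isRoot, Polynomial.IsRoot, aux_eval] at h'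
    obtain ⟨m', G', hG', e'⟩ := aux_div x₀ m G hG h'
    exact ⟨m', G', hG', by rw [hPG, e']; ring⟩

/-- **Singular points at infinity of a homogeneous foliation.**
Let `d ≥ 1` and let `A, B ∈ ℂ[x,y]` be homogeneous of degree `d` with `gcd (A, B) = 1`,
defining the homogeneous foliation `H` by `ω = A dx + B dy`.  Let `x₀ ∈ ℂ` satisfy
`x₀·A(x₀,1) + B(x₀,1) = 0`, i.e. the point `s = [x₀ : 1 : 0]` on the line at infinity is
a singular point of `H`.  Then:
(1) `A(x₀, 1) ≠ 0` (so `ν(H, s) = 1`);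
(2) if `τ` is the order of vanishing at `x = x₀` of the univariate polynomial
`x₀·A(x,1) + B(x,1)`, then `τ ≥ 1` and the linear form `x − x₀·y` divides
`D = A_x·B_y − A_y·B_x` with multiplicity exactly `τ − 1`, i.e.
`D = (x − x₀·y)^(τ−1)·Q` with `Q(x₀, 1) ≠ 0`. -/
theorem stmt_1 (d : ℕ) (hd : 1 ≤ d) (A B : MvPolynomial (Fin 2) ℂ)
    (hA : A.IsHomogeneous d) (hB : B.IsHomogeneous d)
    (hcop : ∀ p : MvPolynomial (Fin 2) ℂ, p ∣ A → p ∣ B → IsUnit p)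
    (x₀ : ℂ)
    (hsing : x₀ * eval ![x₀, 1] A + eval ![x₀, 1] B = 0) :
    eval ![x₀, 1] A ≠ 0 ∧
    ∀ τ : ℕ,
      (Polynomial.X - Polynomial.C x₀) ^ τ ∣
          (Polynomial.C x₀ * dehomY1 A + dehomY1 B) →
      ¬ (Polynomial.X - Polynomial.C x₀) ^ (τ + 1) ∣
          (Polynomial.C x₀ * dehomY1 A + dehomY1 B) →
      1 ≤ τ ∧
      ∃ Q : MvPolynomial (Fin 2) ℂ,
        pderiv 0 A * pderiv 1 B - pderiv 1 A * pderiv 0 B =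
          (X 0 - C x₀ * X 1) ^ (τ - 1) * Q ∧ eval ![x₀, 1] Q ≠ 0 := by
  have hLnu : ¬ IsUnit (X 0 - C x₀ * X 1 : MvPolynomial (Fin 2) ℂ) := fun h => by
    have := h.map (eval ![x₀, 1])
    simp at this
  have h1 : eval ![x₀, 1] A ≠ 0 := by
    intro hA0
    have hB0 : eval ![x₀, 1] B = 0 := by simpa [hA0] using hsing
    obtain ⟨_, G, _, hG⟩ := aux_div x₀ d A hA hA0
    obtain ⟨_, G', _, hG'⟩ := aux_div x₀ d B hB hB0
    exact hLnu (hcop _ ⟨G, hG⟩ ⟨G', hG'⟩)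
  refine ⟨h1, fun τ ht hnt => ?_⟩
  have hF : (C x₀ * A + B).IsHomogeneous d := (hA.C_mul x₀).add hB
  have hdF : Polynomial.C x₀ * dehomY1 A + dehomY1 B = dehomY1 (C x₀ * A + B) := by
    simp [dehomY1]
  rw [hdF] at ht hnt
  have hτ : 1 ≤ τ := by
    rcases Nat.eq_zero_or_pos τ with h | h
    · exfalso
      apply hnt
      rw [h, zero_add, pow_one, Polynomial.dvd_iff_isRoot, Polynomial.IsRoot, aux_eval]
      simpa using hsing
    · exact h
  refine ⟨hτ, ?_⟩
  obtain ⟨m, G, _, hG⟩ := aux_pow x₀ d _ hF τ ht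
  have hG0 : eval ![x₀, 1] G ≠ 0 := by
    intro h
    apply hnt
    rw [← aux_eval] at h
    have e : dehomY1 (C x₀ * A + B) = (Polynomial.X - Polynomial.C x₀) ^ τ * dehomY1 G := by
      rw [← aux_dehomL, hG]; simp only [dehomY1, map_mul, map_pow]
    rw [e, pow_succ]
    exact mul_dvd_mul_left _ (Polynomial.dvd_iff_isRoot.mpr h)
  obtain ⟨t, rfl⟩ : ∃ t, τ = t + 1 := ⟨τ - 1, by omega⟩
  have hBe : B = (X 0 - C x₀ * X 1) ^ (t + 1) * G - C x₀ * A := by rw [← hG]; ring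
  have hE : x₀ * eval ![x₀, 1] (pderiv 0 A) + eval ![x₀, 1] (pderiv 1 A)
      = d * eval ![x₀, 1] A := by
    have := congrArg (eval ![x₀, 1]) hA.sum_X_mul_pderiv
    simpa [Fin.sum_univ_two] using this
  have p0 : pderiv 0 B = (X 0 - C x₀ * X 1) ^ t *
      ((t + 1 : MvPolynomial (Fin 2) ℂ) * G + (X 0 - C x₀ * X 1) * pderiv 0 G)
      - C x₀ * pderiv 0 A := by
    rw [hBe]
    simp [Derivation.leibniz, Derivation.leibniz_pow, pderiv_X]
    ring
  have p1 : pderiv 1 B = (X 0 - C x₀ * X 1) ^ t *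
      (-C x₀ * (t + 1 : MvPolynomial (Fin 2) ℂ) * G + (X 0 - C x₀ * X 1) * pderiv 1 G)
      - C x₀ * pderiv 1 A := by
    rw [hBe]
    simp [Derivation.leibniz, Derivation.leibniz_pow, pderiv_X]
    ring
  refine ⟨pderiv 0 A * (-C x₀ * (t + 1 : MvPolynomial (Fin 2) ℂ) * G
      + (X 0 - C x₀ * X 1) * pderiv 1 G)
    - pderiv 1 A * ((t + 1 : MvPolynomial (Fin 2) ℂ) * G
      + (X 0 - C x₀ * X 1) * pderiv 0 G), ?_, ?_⟩
  · rw [p0, p1, Nat.add_sub_cancel]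
    ring
  · have : eval ![x₀, 1] (pderiv 0 A * (-C x₀ * (t + 1 : MvPolynomial (Fin 2) ℂ) * G
      + (X 0 - C x₀ * X 1) * pderiv 1 G)
    - pderiv 1 A * ((t + 1 : MvPolynomial (Fin 2) ℂ) * G
      + (X 0 - C x₀ * X 1) * pderiv 0 G))
      = -((t + 1 : ℂ) * eval ![x₀, 1] G * (d * eval ![x₀, 1] A)) := by
      rw [← hE]
      simp
      ring
    rw [this]
    have hd0 : (d : ℂ) ≠ 0 := by exact_mod_cast (by omega : d ≠ 0)
    have ht0 : (t + 1 : ℂ) ≠ 0 := by exact_mod_cast Nat.succ_ne_zero t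
    exact neg_ne_zero.mpr (mul_ne_zero (mul_ne_zero ht0 hG0) (mul_ne_zero hd0 h1))
end
end

section
/- Let H be a homogeneous degree-3 foliation of ℙ²(ℂ) given by ω = A dx + B dy with A, B ∈ ℂ[x,y] homogeneous of degree 3 and gcd(A,B) = 1; set C_H = xA + yB and D_H = A_x B_y − A_y B_x. (a) If H is of type 2·T₁ + 1·R₂, i.e. D_H = c·ℓ₁ℓ₂ℓ₃² for some c ∈ ℂ* and pairwise non-proportional linear forms ℓ₁, ℓ₂, ℓ₃ with ℓ₁ ∤ C_H, ℓ₂ ∤ C_H and ℓ₃ ∣ C_H, then ω is linearly conjugate to y³dx + (β·x³ − 3β·xy² + α·y³)dy for some α, β ∈ ℂ with β·((2β−1)² − α²) ≠ 0. (b) If H is of type 2·T₁ + 1·T₂, i.e. D_H = c·ℓ₁ℓ₂ℓ₃² as above but with ℓ₃ ∤ C_H, then ω is linearly conjugate to (x³ − 3xy² + α·y³)dx + (δ·x³ − 3δ·xy² + β·y³)dy for some α, β, δ ∈ ℂ with (β − αδ)·((β−2)² − (α−2δ)²) ≠ 0. -/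
open MvPolynomial

noncomputable section

/-- The linear form `a·x + b·y ∈ ℂ[x,y]` attached to a pair `(a, b) ∈ ℂ²`. -/
def lin (v : ℂ × ℂ) : MvPolynomial (Fin 2) ℂ := C v.1 * X 0 + C v.2 * X 1

/-- Substitution of the linear change of variables on `ℂ²` given by the matrix `M`. -/
def subst2 (M : Matrix (Fin 2) (Fin 2) ℂ) (P : MvPolynomial (Fin 2) ℂ) :
    MvPolynomial (Fin 2) ℂ :=
  aeval (fun i => ∑ j, C (M i j) * X j) P

/-- The 1-forms `ω = A dx + B dy` and `ω' = A' dx + B' dy` are linearly conjugate: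
there are `T ∈ GL₂(ℂ)` and `c ∈ ℂ*` with `T*ω = c·ω'`. -/
def LinConj2 (A B A' B' : MvPolynomial (Fin 2) ℂ) : Prop :=
  ∃ (M : Matrix (Fin 2) (Fin 2) ℂ) (c : ℂ), IsUnit M.det ∧ c ≠ 0 ∧
    C (M 0 0) * subst2 M A + C (M 1 0) * subst2 M B = C c * A' ∧
    C (M 0 1) * subst2 M A + C (M 1 1) * subst2 M B = C c * B'

/-- The inflection polynomial `D = A_x·B_y − A_y·B_x` of the homogeneous 1-form
`ω = A dx + B dy`. -/
def Dpoly (A B : MvPolynomial (Fin 2) ℂ) : MvPolynomial (Fin 2) ℂ :=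
  pderiv 0 A * pderiv 1 B - pderiv 1 A * pderiv 0 B

/-- The tangent cone `C = x·A + y·B` of the homogeneous 1-form `ω = A dx + B dy`. -/
def cone (A B : MvPolynomial (Fin 2) ℂ) : MvPolynomial (Fin 2) ℂ :=
  X 0 * A + X 1 * B

lemma subst2_X (M : Matrix (Fin 2) (Fin 2) ℂ) (i : Fin 2) :
    subst2 M (X i) = C (M i 0) * X 0 + C (M i 1) * X 1 := by
  simp [subst2, Fin.sum_univ_two]

lemma subst2_C (M : Matrix (Fin 2) (Fin 2) ℂ) (c : ℂ) : subst2 M (C c) = C c := by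
  simp [subst2, MvPolynomial.algebraMap_eq]

lemma subst2_mul (M : Matrix (Fin 2) (Fin 2) ℂ) (p q : MvPolynomial (Fin 2) ℂ) :
    subst2 M (p * q) = subst2 M p * subst2 M q := by
  simp [subst2]

lemma subst2_add (M : Matrix (Fin 2) (Fin 2) ℂ) (p q : MvPolynomial (Fin 2) ℂ) :
    subst2 M (p + q) = subst2 M p + subst2 M q := by
  simp [subst2]

lemma subst2_sub (M : Matrix (Fin 2) (Fin 2) ℂ) (p q : MvPolynomial (Fin 2) ℂ) :
    subst2 M (p - q) = subst2 M p - subst2 M q := by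
  simp [subst2]

lemma subst2_dvd (M : Matrix (Fin 2) (Fin 2) ℂ) {p q : MvPolynomial (Fin 2) ℂ}
    (h : p ∣ q) : subst2 M p ∣ subst2 M q := by
  obtain ⟨r, rfl⟩ := h
  exact ⟨subst2 M r, subst2_mul M p r⟩

lemma subst2_subst2 (M N : Matrix (Fin 2) (Fin 2) ℂ) (h : M * N = 1)
    (p : MvPolynomial (Fin 2) ℂ) : subst2 N (subst2 M p) = p := by
  induction p using MvPolynomial.induction_on with
  | C a => simp [subst2_C]
  | add p q hp hq => rw [subst2_add, subst2_add, hp, hq]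
  | mul_X p i hp =>
    rw [subst2_mul, subst2_mul, hp, subst2_X]
    simp only [subst2_add, subst2_mul, subst2_C, subst2_X]
    congr 1
    have e : ∀ j, M i 0 * N 0 j + M i 1 * N 1 j = if i = j then 1 else 0 := by
      intro j; rw [← Matrix.one_apply, ← h, Matrix.mul_apply, Fin.sum_univ_two]
    have e0 := congrArg (C (σ := Fin 2)) (e 0)
    have e1 := congrArg (C (σ := Fin 2)) (e 1)
    simp only [map_add, map_mul] at e0 e1
    fin_cases i <;> simp at e0 e1 ⊢ <;> linear_combination X 0 * e0 + X 1 * e1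

lemma pderiv_subst2 (M : Matrix (Fin 2) (Fin 2) ℂ) (i : Fin 2) (p : MvPolynomial (Fin 2) ℂ) :
    pderiv i (subst2 M p) =
      C (M 0 i) * subst2 M (pderiv 0 p) + C (M 1 i) * subst2 M (pderiv 1 p) := by
  induction p using MvPolynomial.induction_on with
  | C a => simp [subst2_C]; simp [subst2]
  | add p q hp hq => simp only [subst2_add, map_add, hp, hq]; ring
  | mul_X p j hp =>
    simp only [subst2_mul, Derivation.leibniz, smul_eq_mul, hp, subst2_add, subst2_X]
    have h1 : subst2 M (1 : MvPolynomial (Fin 2) ℂ) = 1 := by simp [subst2]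
    have h0 : subst2 M (0 : MvPolynomial (Fin 2) ℂ) = 0 := by simp [subst2]
    fin_cases i <;> fin_cases j <;>
      simp [pderiv_X, h1, h0, subst2_X] <;> ring

/-- The generic binary cubic. -/
def cub (a b c d : ℂ) : MvPolynomial (Fin 2) ℂ :=
  C a * X 0 ^ 3 + C b * (X 0 ^ 2 * X 1) + C c * (X 0 * X 1 ^ 2) + C d * X 1 ^ 3

lemma exists_cub (A : MvPolynomial (Fin 2) ℂ) (hA : A.IsHomogeneous 3) :
    ∃ a b c d, A = cub a b c d := by
  rw [← A.support_sum_monomial_coeff]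
  apply Finset.sum_induction _ (fun p => ∃ a b c d, p = cub a b c d)
  · rintro p q ⟨a, b, c, d, rfl⟩ ⟨a', b', c', d', rfl⟩
    exact ⟨a + a', b + b', c + c', d + d', by simp [cub]; ring⟩
  · exact ⟨0, 0, 0, 0, by simp [cub]⟩
  · intro m hm
    have h := hA (mem_support_iff.1 hm)
    have h3 : m 0 + m 1 = 3 := by
      rw [← h, Finsupp.weight_apply, Finsupp.sum_fintype _ _ (by simp)]
      simp [Fin.sum_univ_two]
    have hmon : monomial m (coeff m A) = C (coeff m A) * (X 0 ^ m 0 * X 1 ^ m 1) := by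
      rw [monomial_eq, Finsupp.prod_fintype _ _ (by simp), Fin.prod_univ_two]
    rw [hmon]
    generalize coeff m A = t
    have : m 0 ≤ 3 := by omega
    obtain h0 | h0 | h0 | h0 : m 0 = 0 ∨ m 0 = 1 ∨ m 0 = 2 ∨ m 0 = 3 := by omega
    · rw [h0, show m 1 = 3 by omega]; exact ⟨0, 0, 0, t, by simp [cub]⟩
    · rw [h0, show m 1 = 2 by omega]; exact ⟨0, 0, t, 0, by simp [cub]⟩
    · rw [h0, show m 1 = 1 by omega]; exact ⟨0, t, 0, 0, by simp [cub]⟩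
    · rw [h0, show m 1 = 0 by omega]; exact ⟨t, 0, 0, 0, by simp [cub]⟩

lemma core (A B : MvPolynomial (Fin 2) ℂ) (hA : A.IsHomogeneous 3) (hB : B.IsHomogeneous 3)
    (k : ℂ) (hk : k ≠ 0)
    (hD : Dpoly A B = C k * ((X 0 - X 1) * (X 0 + X 1) * X 1 ^ 2))
    (hy : ¬ (X 1 ∣ A ∧ X 1 ∣ B)) :
    ∃ a d a' d', A = cub a 0 (-3 * a) d ∧ B = cub a' 0 (-3 * a') d' ∧ a * d' - a' * d ≠ 0 := by
  obtain ⟨a0, a1, a2, a3, rfl⟩ := exists_cub A hA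
  obtain ⟨b0, b1, b2, b3, rfl⟩ := exists_cub B hB
  have key : ∀ x y : ℂ,
      (3 * a0 * x ^ 2 + 2 * a1 * x * y + a2 * y ^ 2) * (b1 * x ^ 2 + 2 * b2 * x * y + 3 * b3 * y ^ 2)
      - (a1 * x ^ 2 + 2 * a2 * x * y + 3 * a3 * y ^ 2) * (3 * b0 * x ^ 2 + 2 * b1 * x * y + b2 * y ^ 2)
      = k * ((x - y) * (x + y) * y ^ 2) := by
    intro x y
    have := congrArg (eval ![x, y]) hD
    simp [Dpoly, cub, pderiv_X, Derivation.leibniz, Derivation.leibniz_pow] at this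
    linear_combination this
  have k10 := key 1 0
  have k01 := key 0 1
  have k11 := key 1 1
  have km1 := key (-1) 1
  have k21 := key 2 1
  have p01 : a0 * b1 - a1 * b0 = 0 := by linear_combination k10 / 3
  have p23 : a2 * b3 - a3 * b2 = - k / 3 := by linear_combination k01 / 3
  have q : 9 * (a0 * b3 - a3 * b0) + 3 * (a1 * b2 - a2 * b1) = k := by
    linear_combination k11 / 2 + km1 / 2 - k10 - k01
  have s1 : 6 * (a0 * b2 - a2 * b0) + 6 * (a1 * b3 - a3 * b1) = 0 := by
    linear_combination k11 / 2 - km1 / 2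
  have s2 : 48 * (a0 * b2 - a2 * b0) + 12 * (a1 * b3 - a3 * b1) = 0 := by
    linear_combination k21 - 16 * k10 - k01 - 4 * q
  have p02 : a0 * b2 - a2 * b0 = 0 := by linear_combination (s2 - 2 * s1) / 36
  have p13 : a1 * b3 - a3 * b1 = 0 := by linear_combination s1 / 6 - p02
  have pl : (a0 * b3 - a3 * b0) * (a1 * b2 - a2 * b1) = 0 := by
    linear_combination (a0 * b2 - a2 * b0) * p13 - (a2 * b3 - a3 * b2) * p01
  rcases mul_eq_zero.1 pl with h | h
  · exfalso
    have p12 : a1 * b2 - a2 * b1 ≠ 0 := by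
      intro h'; apply hk; rw [← q, h, h']; ring
    have ha0 : a0 = 0 := by
      apply (mul_eq_zero.1 (_ : a0 * (a1 * b2 - a2 * b1) = 0)).resolve_right p12
      linear_combination a1 * p02 - a2 * p01
    have hb0 : b0 = 0 := by
      apply (mul_eq_zero.1 (_ : b0 * (a1 * b2 - a2 * b1) = 0)).resolve_right p12
      linear_combination b1 * p02 - b2 * p01
    subst ha0 hb0
    apply hy
    constructor
    · exact ⟨C a1 * X 0 ^ 2 + C a2 * (X 0 * X 1) + C a3 * X 1 ^ 2, by simp [cub]; ring⟩
    · exact ⟨C b1 * X 0 ^ 2 + C b2 * (X 0 * X 1) + C b3 * X 1 ^ 2, by simp [cub]; ring⟩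
  · have p03 : a0 * b3 - a3 * b0 ≠ 0 := by
      intro h'; apply hk; rw [← q, h, h']; ring
    have ha1 : a1 = 0 := by
      apply (mul_eq_zero.1 (_ : a1 * (a0 * b3 - a3 * b0) = 0)).resolve_right p03
      linear_combination a3 * p01 + a0 * p13
    have hb1 : b1 = 0 := by
      apply (mul_eq_zero.1 (_ : b1 * (a0 * b3 - a3 * b0) = 0)).resolve_right p03
      linear_combination b3 * p01 + b0 * p13
    have e : a2 * b3 - a3 * b2 + 3 * (a0 * b3 - a3 * b0) = 0 := by
      linear_combination p23 + q / 3 - h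
    have ha2 : a2 + 3 * a0 = 0 := by
      apply (mul_eq_zero.1 (_ : (a2 + 3 * a0) * (a0 * b3 - a3 * b0) = 0)).resolve_right p03
      linear_combination a0 * e + a3 * p02
    have hb2 : b2 + 3 * b0 = 0 := by
      apply (mul_eq_zero.1 (_ : (b2 + 3 * b0) * (a0 * b3 - a3 * b0) = 0)).resolve_right p03
      linear_combination b0 * e + b3 * p02
    refine ⟨a0, a3, b0, b3, ?_, ?_, ?_⟩
    · rw [ha1, eq_neg_of_add_eq_zero_left ha2, neg_mul]
    · rw [hb1, eq_neg_of_add_eq_zero_left hb2, neg_mul]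
    · intro h'; apply p03; linear_combination h'

lemma reduce (A B : MvPolynomial (Fin 2) ℂ)
    (hA : A.IsHomogeneous 3) (hB : B.IsHomogeneous 3)
    (hcop : ∀ p : MvPolynomial (Fin 2) ℂ, p ∣ A → p ∣ B → IsUnit p)
    (c : ℂ) (l₁ l₂ l₃ : ℂ × ℂ) (hc : c ≠ 0)
    (h12 : l₁.1 * l₂.2 - l₂.1 * l₁.2 ≠ 0)
    (h13 : l₁.1 * l₃.2 - l₃.1 * l₁.2 ≠ 0)
    (h23 : l₂.1 * l₃.2 - l₃.1 * l₂.2 ≠ 0)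
    (hD : Dpoly A B = C c * lin l₁ * lin l₂ * lin l₃ ^ 2) :
    ∃ (M : Matrix (Fin 2) (Fin 2) ℂ) (a d a' d' : ℂ), IsUnit M.det ∧
      C (M 0 0) * subst2 M A + C (M 1 0) * subst2 M B = cub a 0 (-3 * a) d ∧
      C (M 0 1) * subst2 M A + C (M 1 1) * subst2 M B = cub a' 0 (-3 * a') d' ∧
      a * d' - a' * d ≠ 0 ∧
      (lin l₁ ∣ cone A B ↔ X 0 - X 1 ∣ cone (cub a 0 (-3 * a) d) (cub a' 0 (-3 * a') d')) ∧
      (lin l₂ ∣ cone A B ↔ X 0 + X 1 ∣ cone (cub a 0 (-3 * a) d) (cub a' 0 (-3 * a') d')) ∧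
      (lin l₃ ∣ cone A B ↔ X 1 ∣ cone (cub a 0 (-3 * a) d) (cub a' 0 (-3 * a') d')) := by
  obtain ⟨x₁, y₁⟩ := l₁
  obtain ⟨x₂, y₂⟩ := l₂
  obtain ⟨x₃, y₃⟩ := l₃
  simp only at h12 h13 h23
  obtain ⟨d12, e12⟩ : ∃ t, t = x₁ * y₂ - x₂ * y₁ := ⟨_, rfl⟩
  obtain ⟨d13, e13⟩ : ∃ t, t = x₁ * y₃ - x₃ * y₁ := ⟨_, rfl⟩
  obtain ⟨d23, e23⟩ : ∃ t, t = x₂ * y₃ - x₃ * y₂ := ⟨_, rfl⟩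
  rw [← e12] at h12
  rw [← e13] at h13
  rw [← e23] at h23
  obtain ⟨M, hM⟩ : ∃ M : Matrix (Fin 2) (Fin 2) ℂ, M =
    !![d12 * y₃, -d23 * y₁ - d13 * y₂; -d12 * x₃, d23 * x₁ + d13 * x₂] := ⟨_, rfl⟩
  have hdet : M.det = 2 * d12 * d13 * d23 := by
    rw [hM, Matrix.det_fin_two_of, e12, e13, e23]; ring
  have hdet0 : M.det ≠ 0 := by
    rw [hdet]; simp [h12, h13, h23]
  have hu : IsUnit M.det := isUnit_iff_ne_zero.2 hdet0
  have hMN : M * M⁻¹ = 1 := Matrix.mul_nonsing_inv M hu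
  have hNM : M⁻¹ * M = 1 := Matrix.nonsing_inv_mul M hu
  have m00 : M 0 0 = d12 * y₃ := by rw [hM]; rfl
  have m01 : M 0 1 = -d23 * y₁ - d13 * y₂ := by rw [hM]; rfl
  have m10 : M 1 0 = -d12 * x₃ := by rw [hM]; rfl
  have m11 : M 1 1 = d23 * x₁ + d13 * x₂ := by rw [hM]; rfl
  have hlin : ∀ x y : ℂ, subst2 M (lin (x, y)) =
      C (x * M 0 0 + y * M 1 0) * X 0 + C (x * M 0 1 + y * M 1 1) * X 1 := by
    intro x y
    simp only [lin, subst2_add, subst2_mul, subst2_C, subst2_X, map_add, map_mul]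
    ring
  have L1 : subst2 M (lin (x₁, y₁)) = C (d13 * d12) * (X 0 - X 1) := by
    rw [hlin, show x₁ * M 0 0 + y₁ * M 1 0 = d13 * d12 by rw [m00, m10, e12, e13]; ring,
      show x₁ * M 0 1 + y₁ * M 1 1 = -(d13 * d12) by rw [m01, m11, e12, e13]; ring, C_neg]
    ring
  have L2 : subst2 M (lin (x₂, y₂)) = C (d23 * d12) * (X 0 + X 1) := by
    rw [hlin, show x₂ * M 0 0 + y₂ * M 1 0 = d23 * d12 by rw [m00, m10, e12, e23]; ring,
      show x₂ * M 0 1 + y₂ * M 1 1 = d23 * d12 by rw [m01, m11, e12, e23]; ring]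
    ring
  have L3 : subst2 M (lin (x₃, y₃)) = C (2 * d13 * d23) * X 1 := by
    rw [hlin, show x₃ * M 0 0 + y₃ * M 1 0 = 0 by rw [m00, m10]; ring,
      show x₃ * M 0 1 + y₃ * M 1 1 = 2 * d13 * d23 by rw [m01, m11, e13, e23]; ring, C_0]
    ring
  clear hlin
  obtain ⟨A', hA'⟩ : ∃ A', A' = C (M 0 0) * subst2 M A + C (M 1 0) * subst2 M B := ⟨_, rfl⟩
  obtain ⟨B', hB'⟩ : ∃ B', B' = C (M 0 1) * subst2 M A + C (M 1 1) * subst2 M B := ⟨_, rfl⟩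
  have hdetC : C M.det = (C (M 0 0) * C (M 1 1) - C (M 0 1) * C (M 1 0) :
      MvPolynomial (Fin 2) ℂ) := by
    rw [Matrix.det_fin_two]; simp
  have hcone : cone A' B' = subst2 M (cone A B) := by
    simp only [cone, hA', hB', subst2_add, subst2_mul, subst2_X]; ring
  have hDD : Dpoly A' B' = C (M.det ^ 2) * subst2 M (Dpoly A B) := by
    rw [C_pow, hdetC]
    simp only [Dpoly, hA', hB', subst2_sub, subst2_mul, map_add, Derivation.leibniz, smul_eq_mul,
      pderiv_subst2, pderiv_C]
    ring
  have hs : ∀ P : MvPolynomial (Fin 2) ℂ, P.IsHomogeneous 3 → (subst2 M P).IsHomogeneous 3 := by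
    intro P hP
    have := hP.aeval (n := 1) (fun i => ∑ j, C (M i j) * X j) (fun i => by
      apply IsHomogeneous.sum
      intro j _
      simpa using (isHomogeneous_C (Fin 2) (M i j)).mul (isHomogeneous_X ℂ j))
    simpa [subst2] using this
  have hC : ∀ (t : ℂ) (P : MvPolynomial (Fin 2) ℂ), P.IsHomogeneous 3 →
      (C t * P).IsHomogeneous 3 := by
    intro t P hP
    simpa using (isHomogeneous_C (Fin 2) t).mul hP
  have homA : A'.IsHomogeneous 3 := hA' ▸ (hC _ _ (hs _ hA)).add (hC _ _ (hs _ hB))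
  have homB : B'.IsHomogeneous 3 := hB' ▸ (hC _ _ (hs _ hA)).add (hC _ _ (hs _ hB))
  have hdv : ∀ (l P : MvPolynomial (Fin 2) ℂ) (t : ℂ) (L : MvPolynomial (Fin 2) ℂ), t ≠ 0 →
      subst2 M l = C t * L → (l ∣ P ↔ L ∣ subst2 M P) := by
    intro l P t L ht h
    constructor
    · intro hd
      have := subst2_dvd M hd
      rw [h] at this
      exact (Dvd.intro_left _ rfl).trans this
    · intro hd
      have h1 : subst2 M l ∣ subst2 M P := by
        rw [h]
        exact (((isUnit_iff_ne_zero.2 ht).map C).mul_left_dvd).2 hd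
      have := subst2_dvd M⁻¹ h1
      rwa [subst2_subst2 _ _ hMN, subst2_subst2 _ _ hMN] at this
  have hy : ¬ (X 1 ∣ A' ∧ X 1 ∣ B') := by
    rintro ⟨ha, hb⟩
    have t3 : 2 * d13 * d23 ≠ 0 := by simp [h13, h23]
    have i1 : C M.det * subst2 M A = C (M 1 1) * A' - C (M 1 0) * B' := by
      rw [hdetC, hA', hB']; ring
    have i2 : C M.det * subst2 M B = C (M 0 0) * B' - C (M 0 1) * A' := by
      rw [hdetC, hA', hB']; ring
    have hud : IsUnit (C M.det : MvPolynomial (Fin 2) ℂ) := hu.map C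
    have dA : X 1 ∣ subst2 M A := by
      rw [← hud.dvd_mul_left, i1]
      exact dvd_sub (ha.mul_left _) (hb.mul_left _)
    have dB : X 1 ∣ subst2 M B := by
      rw [← hud.dvd_mul_left, i2]
      exact dvd_sub (hb.mul_left _) (ha.mul_left _)
    have hun := hcop _ ((hdv _ A _ _ t3 L3).2 dA) ((hdv _ B _ _ t3 L3).2 dB)
    have h2 := subst2_dvd M (isUnit_iff_dvd_one.1 hun)
    rw [L3, show subst2 M (1 : MvPolynomial (Fin 2) ℂ) = 1 by simp [subst2]] at h2
    have h3 := map_dvd (eval (![0, 0] : Fin 2 → ℂ)) h2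
    simp at h3
  have hD' : Dpoly A' B' = C (M.det ^ 2 * (c * (d13 * d12) * (d23 * d12) * (2 * d13 * d23) ^ 2)) *
      ((X 0 - X 1) * (X 0 + X 1) * X 1 ^ 2) := by
    rw [hDD, hD, pow_two (lin _)]
    simp only [subst2_mul, subst2_C, L1, L2, L3]
    simp only [map_mul, map_pow]
    ring
  obtain ⟨a, d, a', d', rA, rB, hne⟩ := core A' B' homA homB _
    (by simp [hdet0, hc, h12, h13, h23]) hD' hy
  refine ⟨M, a, d, a', d', hu, ?_, ?_, hne, ?_, ?_, ?_⟩
  · rw [← hA', rA]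
  · rw [← hB', rB]
  · rw [← rA, ← rB, hcone]; exact hdv _ _ _ _ (by simp [h13, h12]) L1
  · rw [← rA, ← rB, hcone]; exact hdv _ _ _ _ (by simp [h23, h12]) L2
  · rw [← rA, ← rB, hcone]; exact hdv _ _ _ _ (by simp [h13, h23]) L3

lemma dvd_x_sub (a d a' d' : ℂ) (h : d + d' - 2 * a - 2 * a' = 0) :
    X 0 - X 1 ∣ cone (cub a 0 (-3 * a) d) (cub a' 0 (-3 * a') d') := by
  obtain rfl : d' = 2 * a + 2 * a' - d := by linear_combination h
  refine ⟨C a * X 0 ^ 3 + C (a + a') * X 0 ^ 2 * X 1 + C (a' - 2 * a) * X 0 * X 1 ^ 2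
    + C (d - 2 * a - 2 * a') * X 1 ^ 3, ?_⟩
  simp only [cone, cub, map_add, map_sub, map_mul, map_neg, map_ofNat, C_0]
  ring

lemma dvd_x_add (a d a' d' : ℂ) (h : d' - d - 2 * a + 2 * a' = 0) :
    X 0 + X 1 ∣ cone (cub a 0 (-3 * a) d) (cub a' 0 (-3 * a') d') := by
  obtain rfl : d' = d + 2 * a - 2 * a' := by linear_combination h
  refine ⟨C a * X 0 ^ 3 + C (a' - a) * X 0 ^ 2 * X 1 + C (-2 * a - a') * X 0 * X 1 ^ 2
    + C (d + 2 * a - 2 * a') * X 1 ^ 3, ?_⟩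
  simp only [cone, cub, map_add, map_sub, map_mul, map_neg, map_ofNat, C_0]
  ring

lemma dvd_y (a d a' d' : ℂ) :
    X 1 ∣ cone (cub a 0 (-3 * a) d) (cub a' 0 (-3 * a') d') ↔ a = 0 := by
  constructor
  · intro h
    have := map_dvd (eval (![1, 0] : Fin 2 → ℂ)) h
    simpa [cone, cub] using this
  · rintro rfl
    exact ⟨C d * X 0 * X 1 ^ 2 + cub a' 0 (-3 * a') d', by simp [cone, cub]; ring⟩

/-- **Homogeneous degree-3 foliations of type `2·T₁ + 1·R₂` or `2·T₁ + 1·T₂`.**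
Let `H` be a homogeneous degree-3 foliation of `ℙ²(ℂ)` given by `ω = A dx + B dy`
(`A, B` homogeneous of degree 3, coprime); set `C_H = xA + yB` and
`D_H = A_x B_y − A_y B_x`.
(a) If `D_H = c·ℓ₁ℓ₂ℓ₃²` with `c ∈ ℂ*` and pairwise non-proportional linear forms
`ℓ₁, ℓ₂, ℓ₃` with `ℓ₁ ∤ C_H`, `ℓ₂ ∤ C_H` and `ℓ₃ ∣ C_H`, then `ω` is linearly conjugate
to `y³dx + (β·x³ − 3β·xy² + α·y³)dy` for some `α, β` with `β((2β−1)² − α²) ≠ 0`.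
(b) If `D_H = c·ℓ₁ℓ₂ℓ₃²` as above but `ℓ₃ ∤ C_H`, then `ω` is linearly conjugate to
`(x³ − 3xy² + α·y³)dx + (δ·x³ − 3δ·xy² + β·y³)dy` for some `α, β, δ` with
`(β − αδ)((β−2)² − (α−2δ)²) ≠ 0`. -/
theorem stmt_2 (A B : MvPolynomial (Fin 2) ℂ)
    (hA : A.IsHomogeneous 3) (hB : B.IsHomogeneous 3)
    (hcop : ∀ p : MvPolynomial (Fin 2) ℂ, p ∣ A → p ∣ B → IsUnit p) :
    (∀ (c : ℂ) (l₁ l₂ l₃ : ℂ × ℂ), c ≠ 0 →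
      l₁.1 * l₂.2 - l₂.1 * l₁.2 ≠ 0 →
      l₁.1 * l₃.2 - l₃.1 * l₁.2 ≠ 0 →
      l₂.1 * l₃.2 - l₃.1 * l₂.2 ≠ 0 →
      Dpoly A B = C c * lin l₁ * lin l₂ * lin l₃ ^ 2 →
      ¬ lin l₁ ∣ cone A B → ¬ lin l₂ ∣ cone A B → lin l₃ ∣ cone A B →
      ∃ α β : ℂ, β * ((2 * β - 1) ^ 2 - α ^ 2) ≠ 0 ∧
        LinConj2 A B (X 1 ^ 3)
          (C β * X 0 ^ 3 - C (3 * β) * X 0 * X 1 ^ 2 + C α * X 1 ^ 3)) ∧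
    (∀ (c : ℂ) (l₁ l₂ l₃ : ℂ × ℂ), c ≠ 0 →
      l₁.1 * l₂.2 - l₂.1 * l₁.2 ≠ 0 →
      l₁.1 * l₃.2 - l₃.1 * l₁.2 ≠ 0 →
      l₂.1 * l₃.2 - l₃.1 * l₂.2 ≠ 0 →
      Dpoly A B = C c * lin l₁ * lin l₂ * lin l₃ ^ 2 →
      ¬ lin l₁ ∣ cone A B → ¬ lin l₂ ∣ cone A B → ¬ lin l₃ ∣ cone A B →
      ∃ α β δ : ℂ, (β - α * δ) * ((β - 2) ^ 2 - (α - 2 * δ) ^ 2) ≠ 0 ∧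
        LinConj2 A B
          (X 0 ^ 3 - 3 * X 0 * X 1 ^ 2 + C α * X 1 ^ 3)
          (C δ * X 0 ^ 3 - C (3 * δ) * X 0 * X 1 ^ 2 + C β * X 1 ^ 3)) := by
  constructor
  · intro c l₁ l₂ l₃ hc h12 h13 h23 hD n1 n2 n3
    obtain ⟨M, a, d, a', d', hu, eA, eB, hne, i1, i2, i3⟩ :=
      reduce A B hA hB hcop c l₁ l₂ l₃ hc h12 h13 h23 hD
    rw [i1] at n1
    rw [i2] at n2
    rw [i3, dvd_y] at n3
    subst n3
    have f1 := mt (dvd_x_sub 0 d a' d') n1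
    have f2 := mt (dvd_x_add 0 d a' d') n2
    have hd : d ≠ 0 := by rintro rfl; simp at hne
    have ha' : a' ≠ 0 := by rintro rfl; simp at hne
    refine ⟨d' / d, a' / d, ?_, M, d, hu, hd, ?_, ?_⟩
    · have e : a' / d * ((2 * (a' / d) - 1) ^ 2 - (d' / d) ^ 2) =
          -(a' * (d + d' - 2 * 0 - 2 * a') * (d' - d - 2 * 0 + 2 * a')) / d ^ 3 := by
        field_simp; ring
      rw [e]
      exact div_ne_zero (neg_ne_zero.2 (mul_ne_zero (mul_ne_zero ha' f1) f2)) (pow_ne_zero _ hd)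
    · rw [eA]; simp [cub]
    · have e1 : (C a' : MvPolynomial (Fin 2) ℂ) = C d * C (a' / d) := by
        rw [← C_mul]; congr 1; field_simp
      have e2 : (C d' : MvPolynomial (Fin 2) ℂ) = C d * C (d' / d) := by
        rw [← C_mul]; congr 1; field_simp
      rw [eB]
      simp only [cub, map_mul, map_neg, map_ofNat, C_0, e1, e2]
      ring
  · intro c l₁ l₂ l₃ hc h12 h13 h23 hD n1 n2 n3
    obtain ⟨M, a, d, a', d', hu, eA, eB, hne, i1, i2, i3⟩ :=
      reduce A B hA hB hcop c l₁ l₂ l₃ hc h12 h13 h23 hD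
    rw [i1] at n1
    rw [i2] at n2
    rw [i3, dvd_y] at n3
    have f1 := mt (dvd_x_sub a d a' d') n1
    have f2 := mt (dvd_x_add a d a' d') n2
    have e1 : (C a' : MvPolynomial (Fin 2) ℂ) = C a * C (a' / a) := by
      rw [← C_mul]; congr 1; field_simp
    have e2 : (C d' : MvPolynomial (Fin 2) ℂ) = C a * C (d' / a) := by
      rw [← C_mul]; congr 1; field_simp
    have e3 : (C d : MvPolynomial (Fin 2) ℂ) = C a * C (d / a) := by
      rw [← C_mul]; congr 1; field_simp
    refine ⟨d / a, d' / a, a' / a, ?_, M, a, hu, n3, ?_, ?_⟩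
    · have e : (d' / a - d / a * (a' / a)) * ((d' / a - 2) ^ 2 - (d / a - 2 * (a' / a)) ^ 2) =
          ((a * d' - a' * d) * (d + d' - 2 * a - 2 * a') * (d' - d - 2 * a + 2 * a')) / a ^ 4 := by
        field_simp; ring
      rw [e]
      exact div_ne_zero (mul_ne_zero (mul_ne_zero hne f1) f2) (pow_ne_zero _ n3)
    · rw [eA]
      simp only [cub, map_mul, map_neg, map_ofNat, C_0, e3]
      ring
    · rw [eB]
      simp only [cub, map_mul, map_neg, map_ofNat, C_0, e1, e2]
      ring
end
end
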